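/- arXiv:1007.1501 — 2 statements merged into one kernel-verified Lean document; each statement's English description precedes it below -/
import Mathlib

section
/- Suppose all influences are non-negative (T_{j,i} ≥ 0 for all i, j). For every price p and every vector q ∈ [0,1]^n with q ≤ q̲(p) componentwise, the iterates f_p^{(m)}(q) converge componentwise to q̲(p) as m → ∞. -/
open Filter Topology

/-- med{0,1,x} = max(0, min(1, x)). -/
noncomputable def med (x : ℝ) : ℝ := max 0 (min 1 x)

/-- The transfer function `f_p` of the pricing game. -/
noncomputable def transfer {ι : Type*} [Fintype ι] (a b : ι → ℝ)
    (T : Matrix ι ι ℝ) (p : ℝ) (q : ι → ℝ) : ι → ℝ :=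
  fun i => med ((b i - p + ∑ j, T j i * q j) / (b i - a i))

lemma med_monotone : Monotone med := fun _ _ h => max_le_max le_rfl (min_le_min le_rfl h)

lemma continuous_med : Continuous med := by
  unfold med
  fun_prop

lemma continuous_transfer {ι : Type*} [Fintype ι] (a b : ι → ℝ) (T : Matrix ι ι ℝ) (p : ℝ) :
    Continuous (transfer a b T p) := by
  refine continuous_pi fun i => continuous_med.comp ?_
  fun_prop

lemma transfer_monotone {ι : Type*} [Fintype ι] {a b : ι → ℝ} {T : Matrix ι ι ℝ}
    (hab : ∀ i, a i ≤ b i) (hT : ∀ i j, 0 ≤ T j i) (p : ℝ) :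
    Monotone (transfer a b T p) := by
  intro x y hxy i
  refine med_monotone (div_le_div_of_nonneg_right ?_ (sub_nonneg.2 (hab i)))
  gcongr with j
  · exact hT i j
  · exact hxy j

/-- with non-negative influences, for every price `p` and every
vector `q ∈ [0,1]^n` with `q ≤ q̲(p)` componentwise, the iterates `f_p^{(m)}(q)`
converge componentwise to the pessimistic equilibrium `q̲(p)`. -/
theorem iterates_from_below_converge_to_pessimistic (n : ℕ) (a b : Fin n → ℝ)
    (T : Matrix (Fin n) (Fin n) ℝ)
    (ha : ∀ i, 0 ≤ a i) (hab : ∀ i, a i < b i)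
    (hTdiag : ∀ i, T i i = 0) (hTnn : ∀ i j, 0 ≤ T j i)
    (p : ℝ) (ql : Fin n → ℝ)
    (hql : ∀ i, Tendsto (fun m : ℕ => (transfer a b T p)^[m] (fun _ => 0) i)
      atTop (𝓝 (ql i)))
    (q : Fin n → ℝ) (hq : ∀ i, q i ∈ Set.Icc (0:ℝ) 1)
    (hle : ∀ i, q i ≤ ql i) :
    ∀ i, Tendsto (fun m : ℕ => (transfer a b T p)^[m] q i) atTop (𝓝 (ql i)) := by
  have hmono := transfer_monotone (fun i => (hab i).le) hTnn p
  have hfix : Function.IsFixedPt (transfer a b T p) ql :=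
    isFixedPt_of_tendsto_iterate (tendsto_pi_nhds.2 hql) (continuous_transfer a b T p).continuousAt
  intro i
  refine tendsto_of_tendsto_of_tendsto_of_le_of_le (hql i) tendsto_const_nhds
    (fun m => hmono.iterate m (fun j => (hq j).1) i) fun m => ?_
  have h := hmono.iterate m hle i
  rwa [(hfix.iterate m).eq] at h
end

section
/- Assume all influences are non-negative, I − L is strictly diagonally dominant, p_t is a price, and Z ∪ W ∪ O is an admissible partition at p_t with Z ∪ W ≠ ∅. Define ℓ_W = (I − L_{W×W})^{-1} y_W, ℓ_i = y_i + Σ_{j∈W} L_{i,j} ℓ_j for i ∈ Z ∪ O, ε_min = min( min_{i∈Z} (−[x + Lq^t]_i)/ℓ_i , min_{i∈W} (1 − [x + Lq^t]_i)/ℓ_i ), and r_W(ε) = ε (I − L_{W×W})^{-1} y_W + q^t_W. Then for every ε with 0 < ε ≤ ε_min, the vector q defined by q_i = 0 for i ∈ Z, q_i = [r_W(ε)]_i for i ∈ W, and q_i = 1 for i ∈ O is an equilibrium at price p_t − ε. -/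
open Filter Topology

theorem med_of_nonpos {x : ℝ} (h : x ≤ 0) : med x = 0 :=
  max_eq_left ((min_le_right 1 x).trans h)

theorem med_of_one_le {x : ℝ} (h : 1 ≤ x) : med x = 1 := by
  rw [med, min_eq_left h, max_eq_right zero_le_one]

theorem med_of_mem_Icc {x : ℝ} (h₀ : 0 ≤ x) (h₁ : x ≤ 1) : med x = x := by
  rw [med, min_eq_right h₁, max_eq_right h₀]

/-- If `A` is non-negative with row sums below one, then `1 - A` is invertible. -/
theorem isUnit_det_one_sub_of_sum_row_lt_one {κ : Type*} [Fintype κ] [DecidableEq κ]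
    (A : Matrix κ κ ℝ) (hA : ∀ i j, 0 ≤ A i j) (hsum : ∀ i, ∑ j, A i j < 1) :
    IsUnit (1 - A).det := by
  refine isUnit_iff_ne_zero.mpr (det_ne_zero_of_sum_row_lt_diag fun k => ?_)
  have hoff : ∀ j ∈ Finset.univ.erase k, ‖(1 - A) k j‖ = A k j := fun j hj => by
    simp [Matrix.one_apply_ne (Finset.ne_of_mem_erase hj).symm, abs_of_nonneg (hA k j)]
  have hsplit := Finset.add_sum_erase Finset.univ (A k) (Finset.mem_univ k)
  rw [Finset.sum_congr rfl hoff, Matrix.sub_apply, Matrix.one_apply_eq, Real.norm_eq_abs]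
  exact lt_of_lt_of_le (by linarith [hsum k]) (le_abs_self _)

/-- A solution on `W` of `v = y + A v` with `y` positive and `A` non-negative with row sums
below one is positive. -/
theorem pos_of_eq_add_sum {ι : Type*} {A : Matrix ι ι ℝ} {y v : ι → ℝ} {W : Finset ι}
    (hA : ∀ i j, 0 ≤ A i j) (hsum : ∀ i ∈ W, ∑ j ∈ W, A i j < 1) (hy : ∀ i ∈ W, 0 < y i)
    (hv : ∀ i ∈ W, v i = y i + ∑ j ∈ W, A i j * v j) : ∀ i ∈ W, 0 < v i := by
  intro i hi
  obtain ⟨m, hm, hmin⟩ := W.exists_min_image v ⟨i, hi⟩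
  have hle : (∑ j ∈ W, A m j) * v m ≤ ∑ j ∈ W, A m j * v j := by
    rw [Finset.sum_mul]
    exact Finset.sum_le_sum fun j hj => mul_le_mul_of_nonneg_left (hmin j hj) (hA m j)
  have hprod : 0 < (1 - ∑ j ∈ W, A m j) * v m := by linarith [hv m hm, hy m hm]
  exact ((pos_iff_pos_of_mul_pos hprod).mp (sub_pos.mpr (hsum m hm))).trans_le (hmin i hi)

/-- with non-negative influences and `I − L` strictly diagonally
dominant, given an admissible partition `Z ∪ W ∪ O` at price `p_t` with
`Z ∪ W ≠ ∅`, for every `0 < ε ≤ ε_min` the vector `⟨0_Z, r_W(ε), 1_O⟩` is an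
equilibrium at price `p_t − ε`, where
`r_W(ε) = ε (I − L_{W×W})⁻¹ y_W + q^t_W`. -/
theorem sweep_step_is_equilibrium (n : ℕ) (a b : Fin n → ℝ)
    (T : Matrix (Fin n) (Fin n) ℝ)
    (ha : ∀ i, 0 ≤ a i) (hab : ∀ i, a i < b i)
    (hTdiag : ∀ i, T i i = 0) (hTnn : ∀ i j, 0 ≤ T j i)
    (L : Matrix (Fin n) (Fin n) ℝ) (hL : ∀ i j, L i j = T j i / (b i - a i))
    (hdd : ∀ i, ∑ j, L i j < 1)
    (pt : ℝ) (qt : Fin n → ℝ)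
    -- q^t = q̲(p_t), the pessimistic equilibrium at price p_t
    (hqt : ∀ i, Tendsto (fun m : ℕ => (transfer a b T pt)^[m] (fun _ => 0) i)
      atTop (𝓝 (qt i)))
    (x y : Fin n → ℝ)
    (hx : ∀ i, x i = (b i - pt) / (b i - a i))
    (hy : ∀ i, y i = 1 / (b i - a i))
    -- admissible partition at p_t
    (Z W O : Finset (Fin n))
    (hZW : Disjoint Z W) (hZO : Disjoint Z O) (hWO : Disjoint W O)
    (hunion : Z ∪ W ∪ O = Finset.univ)
    (hZ : ∀ i ∈ Z, qt i = 0 ∧ (x + L.mulVec qt) i < 0)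
    (hW : ∀ i ∈ W, qt i = (x + L.mulVec qt) i ∧ 0 ≤ qt i ∧ qt i < 1)
    (hO : ∀ i ∈ O, qt i = 1 ∧ 1 ≤ (x + L.mulVec qt) i)
    (hne : (Z ∪ W).Nonempty)
    (Lw : Matrix {i // i ∈ W} {i // i ∈ W} ℝ) (hLw : ∀ i j, Lw i j = L i.1 j.1)
    (ℓ : Fin n → ℝ)
    (hℓW : ∀ i (h : i ∈ W),
      ℓ i = (1 - Lw)⁻¹.mulVec (fun j => y j.1) ⟨i, h⟩)
    (hℓZO : ∀ i, i ∉ W → ℓ i = y i + ∑ j ∈ W, L i j * ℓ j)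
    (εmin : ℝ)
    (hεmin : IsLeast ({z | ∃ i ∈ Z, z = -((x + L.mulVec qt) i) / ℓ i} ∪
      {z | ∃ i ∈ W, z = (1 - (x + L.mulVec qt) i) / ℓ i}) εmin)
    (ε : ℝ) (hε : 0 < ε) (hεle : ε ≤ εmin)
    (q : Fin n → ℝ)
    (hq : ∀ i, q i = if i ∈ Z then 0
      else if h : i ∈ W then
        ε * (1 - Lw)⁻¹.mulVec (fun j => y j.1) ⟨i, h⟩ + qt i
      else 1) :
    transfer a b T (pt - ε) q = q := by
  have hd : ∀ i, 0 < b i - a i := fun i => sub_pos.mpr (hab i)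
  have hLnn : ∀ i j, 0 ≤ L i j := fun i j => by
    rw [hL]; exact div_nonneg (hTnn i j) (hd i).le
  have hypos : ∀ i, 0 < y i := fun i => by
    rw [hy]; exact one_div_pos.mpr (hd i)
  have hsumW : ∀ i, ∑ j ∈ W, L i j < 1 := fun i =>
    (Finset.sum_le_univ_sum_of_nonneg (hLnn i)).trans_lt (hdd i)
  have hunit : IsUnit (1 - Lw).det := by
    refine isUnit_det_one_sub_of_sum_row_lt_one Lw (fun i j => hLw i j ▸ hLnn _ _) fun i => ?_
    simp only [hLw]
    rw [Finset.sum_coe_sort W (L i.1)]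
    exact hsumW i
  have hfix : ∀ i, ℓ i = y i + ∑ j ∈ W, L i j * ℓ j := by
    intro i
    by_cases hi : i ∈ W
    · have hsol : (1 - Lw).mulVec (fun j => ℓ j.1) = fun j => y j.1 := by
        rw [show (fun j : {i // i ∈ W} => ℓ j.1) = (1 - Lw)⁻¹.mulVec (fun j => y j.1) from
          funext fun j => hℓW j.1 j.2, Matrix.mulVec_mulVec, Matrix.mul_nonsing_inv _ hunit,
          Matrix.one_mulVec]
      have hrow := congrFun hsol ⟨i, hi⟩
      rw [Matrix.sub_mulVec, Matrix.one_mulVec, Pi.sub_apply] at hrow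
      simp only [Matrix.mulVec, dotProduct, hLw] at hrow
      rw [Finset.sum_coe_sort W (fun j => L i j * ℓ j)] at hrow
      linarith
    · exact hℓZO i hi
  have hposW : ∀ i ∈ W, 0 < ℓ i :=
    pos_of_eq_add_sum hLnn (fun i _ => hsumW i) (fun i _ => hypos i) fun i _ => hfix i
  have hpos : ∀ i, 0 < ℓ i := fun i => by
    rw [hfix i]
    exact add_pos_of_pos_of_nonneg (hypos i)
      (Finset.sum_nonneg fun j hj => mul_nonneg (hLnn i j) (hposW j hj).le)
  have hcover : ∀ i, i ∉ Z → i ∉ W → i ∈ O := fun i hiZ hiW => by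
    have := hunion ▸ Finset.mem_univ i
    simpa [hiZ, hiW] using this
  have hqeq : ∀ i, q i = qt i + if i ∈ W then ε * ℓ i else 0 := by
    intro i
    rw [hq i]
    by_cases hiZ : i ∈ Z
    · simp [hiZ, Finset.disjoint_left.mp hZW hiZ, (hZ i hiZ).1]
    · by_cases hiW : i ∈ W
      · simp [hiZ, hiW, hℓW i hiW, add_comm]
      · simp [hiZ, hiW, (hO i (hcover i hiZ hiW)).1]
  have harg : ∀ i, (b i - (pt - ε) + ∑ j, T j i * q j) / (b i - a i)
      = (x + L.mulVec qt) i + ε * ℓ i := by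
    intro i
    have hTq : (∑ j, T j i * q j) / (b i - a i)
        = L.mulVec qt i + ε * ∑ j ∈ W, L i j * ℓ j := by
      simp only [Matrix.mulVec, dotProduct, Finset.sum_div, Finset.mul_sum]
      rw [← Finset.univ_inter W, ← Finset.sum_ite_mem, ← Finset.sum_add_distrib]
      refine Finset.sum_congr rfl fun j _ => ?_
      rw [hqeq j, hL i j]
      split_ifs <;> ring
    rw [add_div, hTq, hfix i, Pi.add_apply, hx, hy]
    ring
  funext i
  rw [transfer, harg i]
  by_cases hiZ : i ∈ Z
  · have hle := (le_div_iff₀ (hpos i)).mp (hεle.trans (hεmin.2 (Or.inl ⟨i, hiZ, rfl⟩)))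
    rw [med_of_nonpos (by linarith), hq i, if_pos hiZ]
  · by_cases hiW : i ∈ W
    · have hle := (le_div_iff₀ (hpos i)).mp (hεle.trans (hεmin.2 (Or.inr ⟨i, hiW, rfl⟩)))
      obtain ⟨hfixed, hnonneg, -⟩ := hW i hiW
      have hstep := mul_pos hε (hpos i)
      rw [med_of_mem_Icc (by linarith) (by linarith), hqeq i, if_pos hiW, ← hfixed]
    · obtain ⟨hone, hge⟩ := hO i (hcover i hiZ hiW)
      have hstep := mul_pos hε (hpos i)
      rw [med_of_one_le (by linarith), hqeq i, if_neg hiW, hone, add_zero]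
end
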